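/- Colorful counterexample with overlaps: There exists a finite ordered family of compact convex sets in ℝ² colored red, green, and blue (with overlapping sets), together with percent-area functions f and α = 0.3, such that every choice of three differently colored sets Aᵢ, Aⱼ, Aₖ with i < j < k admits an (f,α)-transversal intersecting them in order, yet for each of the three colors there is no line that is an (f,α)-stabber of all the sets of that color. Hence disjointness is necessary in the colorful quantitative Hadwiger theorem. -/

import Mathlib

open MeasureTheory TopologicalSpace
open scoped Classical

noncomputable section

/-- The plane. -/
abbrev Pt : Type := ℝ × ℝ

/-- Planar cross product. -/
def pcross (v w : Pt) : ℝ := v.1 * w.2 - v.2 * w.1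

/-- A directed line in the plane: a base point and a nonzero direction vector. -/
structure DLine : Type where
  p : Pt
  v : Pt
  hv : v ≠ 0

/-- The closed half-plane to the left of a directed line. -/
def DLine.left (ℓ : DLine) : Set Pt := {q | 0 ≤ pcross ℓ.v (q - ℓ.p)}

/-- The closed half-plane to the right of a directed line. -/
def DLine.right (ℓ : DLine) : Set Pt := {q | pcross ℓ.v (q - ℓ.p) ≤ 0}

/-- The set of points of the line. -/
def DLine.line (ℓ : DLine) : Set Pt := {q | pcross ℓ.v (q - ℓ.p) = 0}

/-- Parametrization of the line along its direction. -/
def DLine.pt (ℓ : DLine) (t : ℝ) : Pt := ℓ.p + t • ℓ.v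

/-- `f` is a monotone function on convex sets. -/
def MonoConvex (f : Set Pt → ℝ) : Prop :=
  ∀ A B : Set Pt, Convex ℝ A → Convex ℝ B → A ⊆ B → f A ≤ f B

/-- `ℓ` is an `(f, α)`-stabber of `C`. -/
def Stabs (f : Set Pt → ℝ) (α : ℝ) (ℓ : DLine) (C : Set Pt) : Prop :=
  α ≤ f (ℓ.left ∩ C) ∧ α ≤ f (ℓ.right ∩ C)

/-- `ℓ` meets the sets `C 0, …, C (k-1)` in this order along its direction. -/
def MeetsInOrder (ℓ : DLine) {k : ℕ} (C : Fin k → Set Pt) : Prop :=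
  ∃ t : Fin k → ℝ, Monotone t ∧ ∀ m, ℓ.pt (t m) ∈ C m

/-- `ℓ` meets three sets in the order `A, B, C`. -/
def Meets3 (ℓ : DLine) (A B C : Set Pt) : Prop :=
  ∃ s t u : ℝ, s ≤ t ∧ t ≤ u ∧ ℓ.pt s ∈ A ∧ ℓ.pt t ∈ B ∧ ℓ.pt u ∈ C

/-- `f` is continuous with respect to the Hausdorff metric on nonempty compact sets. -/
def HausCont (f : Set Pt → ℝ) : Prop :=
  Continuous fun K : NonemptyCompacts Pt => f (K : Set Pt)

/-- The percent-area (normalized area) function of `K`. -/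
def pArea (K : Set Pt) (C : Set Pt) : ℝ :=
  (volume (C ∩ K)).toReal / (volume K).toReal

/-- `ℓ` is an `(f, α)`-stabber of `K` for the percent-area function of `K`. -/
def StabsPA (α : ℝ) (ℓ : DLine) (K : Set Pt) : Prop :=
  α ≤ pArea K (ℓ.left ∩ K) ∧ α ≤ pArea K (ℓ.right ∩ K)

/-- The reduced set `C'`: points of `C` through which the line in direction `v`
is an `(f, α)`-stabber of `C` (i.e. `C` minus the maximal pieces of `f`-value `< α`
on each side). -/
def reduceSet (f : Set Pt → ℝ) (α : ℝ) (v : Pt) (hv : v ≠ 0) (C : Set Pt) : Set Pt :=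
  {x ∈ C | Stabs f α ⟨x, v, hv⟩ C}

/-- The middle value of three reals. -/
def mid3 (a b c : ℝ) : ℝ := a + b + c - max a (max b c) - min a (min b c)

/-- The colorful `(f, α)`-separating sign of a set with respect to a directed line. -/
def signOf (f : Set Pt → ℝ) (α : ℝ) (ℓ : DLine) (C : Set Pt) : ℤ :=
  if Stabs f α ℓ C then 0 else if f (ℓ.right ∩ C) < α then -1 else 1

/-- The middle `(f, α)`-separating line of a colored family in direction `d`:
the line parallel to `d` crossing `d^⊥` at `(u₂ + v₂)/2`, where `u₂` (resp. `v₂`)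
is the middle value of the color-wise sups (resp. infs) of the endpoints of the
projections of the reduced sets onto `d^⊥`. -/
def middleLine (f : Set Pt → ℝ) (α : ℝ) (d : Pt) (hd : d ≠ 0)
    {n : ℕ} (C : Fin n → Set Pt) (color : Fin n → Fin 3) : DLine :=
  let a : Fin n → ℝ := fun i => sInf ((fun x => pcross d x) '' reduceSet f α d hd (C i))
  let b : Fin n → ℝ := fun i => sSup ((fun x => pcross d x) '' reduceSet f α d hd (C i))
  let p : Fin 3 → ℝ := fun c => sSup (a '' {i | color i = c})
  let q : Fin 3 → ℝ := fun c => sInf (b '' {i | color i = c})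
  let θ : ℝ := (mid3 (p 0) (p 1) (p 2) + mid3 (q 0) (q 1) (q 2)) / 2
  ⟨(θ / (d.1 ^ 2 + d.2 ^ 2)) • (-d.2, d.1), d, hd⟩

/-- A colored sign vector is balanced if for every two colors there is a coordinate
of one color equal to `1` and a coordinate of the other color equal to `-1`. -/
def BalancedVec {n : ℕ} (x : Fin n → ℤ) (color : Fin n → Fin 3) : Prop :=
  ∀ c₁ c₂ : Fin 3, c₁ ≠ c₂ → ∃ i j : Fin n, color i = c₁ ∧ color j = c₂ ∧
    ((x i = 1 ∧ x j = -1) ∨ (x i = -1 ∧ x j = 1))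

/-- A colored sign vector is Hadwiger if no three increasing, differently colored
coordinates form the pattern `(-1, 1, -1)` or `(1, -1, 1)`. -/
def HadwigerVec {n : ℕ} (x : Fin n → ℤ) (color : Fin n → Fin 3) : Prop :=
  ∀ i j k : Fin n, i < j → j < k →
    color i ≠ color j → color i ≠ color k → color j ≠ color k →
    ¬ ((x i = -1 ∧ x j = 1 ∧ x k = -1) ∨ (x i = 1 ∧ x j = -1 ∧ x k = 1))

/-- The axis-aligned rectangle `[0,a] × [0,b]`. -/
def rect (a b : ℝ) : Set Pt := Set.Icc (0:ℝ) a ×ˢ Set.Icc (0:ℝ) b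

/-- The two short (vertical) sides of the rectangle `[0,a] × [0,b]` (for `b < a`). -/
def shortSides (a b : ℝ) : Set Pt :=
  ({(0:ℝ)} ×ˢ Set.Icc (0:ℝ) b) ∪ ({a} ×ˢ Set.Icc (0:ℝ) b)

/-- A directed line does not intersect the short sides of the rectangle. -/
def avoidsShort (a b : ℝ) (ℓ : DLine) : Prop := ℓ.line ∩ shortSides a b = ∅

/-- Every directed line through `p` avoiding the short sides cuts the rectangle into
pieces of area fractions exactly `α` and `1 - α`. -/
def cutsExactly (a b α : ℝ) (p : Pt) : Prop :=
  ∀ ℓ : DLine, p ∈ ℓ.line → avoidsShort a b ℓ →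
    ((pArea (rect a b) (ℓ.left ∩ rect a b) = α ∧
        pArea (rect a b) (ℓ.right ∩ rect a b) = 1 - α) ∨
     (pArea (rect a b) (ℓ.left ∩ rect a b) = 1 - α ∧
        pArea (rect a b) (ℓ.right ∩ rect a b) = α))

/-- The axis-parallel square of side `2` centered at `c`. -/
def sqr (c : Pt) : Set Pt := Set.Icc (c.1 - 1) (c.1 + 1) ×ˢ Set.Icc (c.2 - 1) (c.2 + 1)

lemma vol_rect (a b c d : ℝ) :
    volume (Set.Icc a b ×ˢ Set.Icc c d : Set Pt) = ENNReal.ofReal (b - a) * ENNReal.ofReal (d - c) := by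
  rw [Measure.volume_eq_prod, Measure.prod_prod, Real.volume_Icc, Real.volume_Icc]

lemma vol_sq (c : Pt) : volume (sqr c) = ENNReal.ofReal 4 := by
  rw [sqr, vol_rect, ← ENNReal.ofReal_mul (by linarith)]
  congr 1
  ring

/-- A piece of the square containing a rectangle of area at least `1.2` has fraction `≥ 0.3`. -/
lemma pArea_lower (c : Pt) (S : Set Pt) (x₀ x₁ y₀ y₁ : ℝ) (hx : x₀ ≤ x₁)
    (hsub : (Set.Icc x₀ x₁ ×ˢ Set.Icc y₀ y₁ : Set Pt) ⊆ S ∩ sqr c)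
    (harea : 1.2 ≤ (x₁ - x₀) * (y₁ - y₀)) : 0.3 ≤ pArea (sqr c) S := by
  unfold pArea
  have h1 := measure_mono (μ := volume) hsub
  have hfin : volume (S ∩ sqr c) ≠ ⊤ :=
    ne_top_of_le_ne_top (by rw [vol_sq]; exact ENNReal.ofReal_ne_top)
      (measure_mono (μ := volume) Set.inter_subset_right)
  rw [vol_rect, ← ENNReal.ofReal_mul (by linarith), ENNReal.ofReal_le_iff_le_toReal hfin] at h1
  rw [vol_sq, ENNReal.toReal_ofReal (by norm_num), le_div_iff₀ (by norm_num)]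
  norm_num at harea ⊢
  linarith

/-- A piece of the square contained in a set of area below `1.2` has fraction `< 0.3`. -/
lemma pArea_upper (c : Pt) (S T : Set Pt) (r : ℝ) (hr0 : 0 ≤ r) (hr : r < 1.2)
    (hsub : S ∩ sqr c ⊆ T) (hT : volume T ≤ ENNReal.ofReal r) : pArea (sqr c) S < 0.3 := by
  unfold pArea
  have h1 : (volume (S ∩ sqr c)).toReal ≤ r :=
    ENNReal.toReal_le_of_le_ofReal hr0 ((measure_mono hsub).trans hT)
  rw [vol_sq, ENNReal.toReal_ofReal (by norm_num), div_lt_iff₀ (by norm_num)]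
  norm_num at hr ⊢
  linarith

/-- Parabola thickness function dominating the length of the sections. -/
def qf (m c y : ℝ) : ℝ := 3 / 50 + (9 / 10 + m * (y - c)) ^ 2 / (12 / 5)

lemma vol_parab (m c : ℝ) (hm : m ^ 2 ≤ 1) (f g : ℝ → ℝ) (hf : Continuous f) (hg : Continuous g)
    (hfg : ∀ y, g y - f y = qf m c y) :
    volume (regionBetween f g (Set.Icc (c - 1) (c + 1)) : Set Pt) ≤ ENNReal.ofReal 1.1 := by
  rw [Measure.volume_eq_prod, volume_regionBetween_eq_integral
    (hf.continuousOn.integrableOn_compact isCompact_Icc)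
    (hg.continuousOn.integrableOn_compact isCompact_Icc) measurableSet_Icc
    (by
      intro y _
      have := hfg y
      unfold qf at this
      nlinarith [sq_nonneg (9 / 10 + m * (y - c))])]
  apply ENNReal.ofReal_le_ofReal
  have e : g - f = qf m c := funext hfg
  rw [e, integral_Icc_eq_integral_Ioc, ← intervalIntegral.integral_of_le (by linarith)]
  have key : ∀ y ∈ Set.uIcc (c - 1) (c + 1), HasDerivAt
      (fun y : ℝ => 3 / 50 * (y - c) + (81 / 100 * (y - c) + 9 / 10 * m * (y - c) ^ 2
        + m ^ 2 * (y - c) ^ 3 / 3) / (12 / 5)) (qf m c y) y := by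
    intro y _
    have h0 : HasDerivAt (fun y : ℝ => y - c) 1 y := (hasDerivAt_id y).sub_const c
    have h := (h0.const_mul (3 / 50)).add
      ((((h0.const_mul (81 / 100)).add ((h0.pow 2).const_mul (9 / 10 * m))).add
        (((h0.pow 3).const_mul (m ^ 2)).div_const 3)).div_const (12 / 5))
    refine HasDerivAt.congr_deriv h ?_
    unfold qf
    norm_num
    ring
  rw [intervalIntegral.integral_eq_sub_of_hasDerivAt key
    (Continuous.intervalIntegrable (by unfold qf; fun_prop) _ _)]
  norm_num
  nlinarith

lemma sq_div_le (a b : ℝ) (ha : a ≠ 0) (hab : |b| ≤ |a|) : (b / a) ^ 2 ≤ 1 := by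
  rw [div_pow, div_le_one (by positivity)]
  exact sq_le_sq.mpr hab

/-- For each dominated direction there is a small-area region, in coordinates (minor, major). -/
lemma small_region (c₁ c₂ a b : ℝ) (ha : a ≠ 0) (hab : |b| ≤ |a|) :
    ∃ T : Set Pt, volume T ≤ ENNReal.ofReal 1.1 ∧
      ∀ x ∈ Set.Icc (c₁ - 1) (c₁ + 1), ∀ y ∈ Set.Icc (c₂ - 1) (c₂ + 1),
        7 / 10 * |a| ≤ a * (x - c₁) + b * (y - c₂) → ((y, x) : Pt) ∈ T := by
  have hm := sq_div_le a b ha hab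
  rcases lt_or_gt_of_ne ha with h | h
  · refine ⟨regionBetween (fun _ => c₁ - 1 - 1 / 20)
      (fun y => c₁ - 1 - 1 / 20 + qf (-(b / a)) c₂ y) (Set.Icc (c₂ - 1) (c₂ + 1)),
      vol_parab (-(b / a)) c₂ (by simpa using hm) _ _ (by fun_prop) (by unfold qf; fun_prop)
        (by intro y; ring), ?_⟩
    intro x hx y hy hxy
    refine ⟨hy, ?_⟩
    rw [abs_of_neg h] at hxy
    obtain ⟨m, rfl⟩ : ∃ m, b = m * a := ⟨b / a, by field_simp⟩
    have hd : m * a / a = m := by field_simp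
    have hxy' : 7 / 10 ≤ -(x - c₁) + -m * (y - c₂) := by
      by_contra hcon
      push Not at hcon
      nlinarith
    constructor
    · simp only
      linarith [hx.1]
    · simp only [hd, qf]
      nlinarith [sq_nonneg (-m * (y - c₂) - 3 / 10)]
  · refine ⟨regionBetween (fun y => c₁ + 1 + 1 / 20 - qf (b / a) c₂ y)
      (fun _ => c₁ + 1 + 1 / 20) (Set.Icc (c₂ - 1) (c₂ + 1)),
      vol_parab (b / a) c₂ hm _ _ (by unfold qf; fun_prop) (by fun_prop)
        (by intro y; ring), ?_⟩
    intro x hx y hy hxy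
    refine ⟨hy, ?_⟩
    rw [abs_of_pos h] at hxy
    obtain ⟨m, rfl⟩ : ∃ m, b = m * a := ⟨b / a, by field_simp⟩
    have hd : m * a / a = m := by field_simp
    have hxy' : 7 / 10 ≤ (x - c₁) + m * (y - c₂) := by
      by_contra hcon
      push Not at hcon
      nlinarith
    constructor
    · simp only [hd, qf]
      nlinarith [sq_nonneg (m * (y - c₂) - 3 / 10)]
    · simp only
      linarith [hx.2]

/-- A piece cut off far from the center (first coordinate dominant) is small. -/
lemma small_fst (c : Pt) (S : Set Pt) (a b : ℝ) (ha : a ≠ 0) (hab : |b| ≤ |a|)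
    (hS : ∀ q ∈ S, 7 / 10 * |a| ≤ a * (q.1 - c.1) + b * (q.2 - c.2)) :
    pArea (sqr c) S < 0.3 := by
  obtain ⟨T, hT, hT'⟩ := small_region c.1 c.2 a b ha hab
  have hsw : MeasurePreserving (MeasurableEquiv.prodComm : Pt ≃ᵐ Pt) volume volume := by
    rw [Measure.volume_eq_prod]
    exact Measure.measurePreserving_swap
  refine pArea_upper c S ((MeasurableEquiv.prodComm : Pt ≃ᵐ Pt) ⁻¹' T) 1.1 (by norm_num)
    (by norm_num) ?_ ?_
  · rintro ⟨x, y⟩ ⟨h1, h2⟩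
    exact hT' x h2.1 y h2.2 (hS _ h1)
  · rw [hsw.measure_preimage_equiv]
    exact hT

/-- A piece cut off far from the center (second coordinate dominant) is small. -/
lemma small_snd (c : Pt) (S : Set Pt) (a b : ℝ) (hb : b ≠ 0) (hab : |a| ≤ |b|)
    (hS : ∀ q ∈ S, 7 / 10 * |b| ≤ a * (q.1 - c.1) + b * (q.2 - c.2)) :
    pArea (sqr c) S < 0.3 := by
  obtain ⟨T, hT, hT'⟩ := small_region c.2 c.1 b a hb hab
  refine pArea_upper c S T 1.1 (by norm_num) (by norm_num) ?_ hT
  rintro ⟨x, y⟩ ⟨h1, h2⟩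
  exact hT' y h2.2 x h2.1 (by linarith [hS _ h1])

/-- The centers of the four squares. -/
def ctr : Fin 4 → Pt := ![(7 / 10, 0), (-(7 / 10), 0), (0, 7 / 10), (0, -(7 / 10))]

/-- No line is a `0.3`-stabber of all four squares. -/
lemma no_common (ℓ : DLine) (h : ∀ m, StabsPA 0.3 ℓ (sqr (ctr m))) : False := by
  obtain ⟨⟨p₁, p₂⟩, ⟨v₁, v₂⟩, hv⟩ := ℓ
  have hv' : v₁ ≠ 0 ∨ v₂ ≠ 0 := by
    by_contra hcon
    push Not at hcon
    exact hv (by rw [hcon.1, hcon.2]; rfl)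
  have L : ∀ m, ¬ pArea (sqr (ctr m)) (DLine.left ⟨(p₁, p₂), (v₁, v₂), hv⟩ ∩ sqr (ctr m)) < 0.3 :=
    fun m => not_lt.mpr (h m).1
  have R : ∀ m, ¬ pArea (sqr (ctr m)) (DLine.right ⟨(p₁, p₂), (v₁, v₂), hv⟩ ∩ sqr (ctr m)) < 0.3 :=
    fun m => not_lt.mpr (h m).2
  rcases le_total |v₁| |v₂| with hle | hle
  · have h2 : v₂ ≠ 0 := by
      rintro rfl
      simp at hle
      tauto
    rcases le_total 0 (v₂ * p₁ - v₁ * p₂) with hF | hF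
    · rcases lt_or_gt_of_ne h2 with hs | hs
      · refine R 0 (small_fst _ _ v₂ (-v₁) h2 (by simpa using hle) ?_)
        rintro ⟨x, y⟩ ⟨hq, _⟩
        simp [DLine.right, pcross] at hq
        simp [ctr, abs_of_neg hs]
        nlinarith
      · refine R 1 (small_fst _ _ v₂ (-v₁) h2 (by simpa using hle) ?_)
        rintro ⟨x, y⟩ ⟨hq, _⟩
        simp [DLine.right, pcross] at hq
        simp [ctr, abs_of_pos hs]
        nlinarith
    · rcases lt_or_gt_of_ne h2 with hs | hs
      · refine L 1 (small_fst _ _ (-v₂) v₁ (by simpa using h2) (by simpa using hle) ?_)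
        rintro ⟨x, y⟩ ⟨hq, _⟩
        simp [DLine.left, pcross] at hq
        simp [ctr, abs_of_neg hs]
        nlinarith
      · refine L 0 (small_fst _ _ (-v₂) v₁ (by simpa using h2) (by simpa using hle) ?_)
        rintro ⟨x, y⟩ ⟨hq, _⟩
        simp [DLine.left, pcross] at hq
        simp [ctr, abs_of_pos hs]
        nlinarith
  · have h1 : v₁ ≠ 0 := by
      rintro rfl
      simp at hle
      tauto
    rcases le_total 0 (v₂ * p₁ - v₁ * p₂) with hF | hF
    · rcases lt_or_gt_of_ne h1 with hs | hs
      · refine R 3 (small_snd _ _ v₂ (-v₁) (by simpa using h1) (by simpa using hle) ?_)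
        rintro ⟨x, y⟩ ⟨hq, _⟩
        simp [DLine.right, pcross] at hq
        simp [ctr, abs_of_neg hs]
        nlinarith
      · refine R 2 (small_snd _ _ v₂ (-v₁) (by simpa using h1) (by simpa using hle) ?_)
        rintro ⟨x, y⟩ ⟨hq, _⟩
        simp [DLine.right, pcross] at hq
        simp [ctr, abs_of_pos hs]
        nlinarith
    · rcases lt_or_gt_of_ne h1 with hs | hs
      · refine L 2 (small_snd _ _ (-v₂) v₁ h1 (by simpa using hle) ?_)
        rintro ⟨x, y⟩ ⟨hq, _⟩
        simp [DLine.left, pcross] at hq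
        simp [ctr, abs_of_neg hs]
        nlinarith
      · refine L 3 (small_snd _ _ (-v₂) v₁ h1 (by simpa using hle) ?_)
        rintro ⟨x, y⟩ ⟨hq, _⟩
        simp [DLine.left, pcross] at hq
        simp [ctr, abs_of_pos hs]
        nlinarith

/-- The vertical line `x = t`. -/
def vline (t : ℝ) : DLine := ⟨(t, 0), (0, 1), by simp⟩

/-- The horizontal line `y = t`. -/
def hline (t : ℝ) : DLine := ⟨(0, t), (1, 0), by simp⟩

lemma stab_v (c : Pt) (t : ℝ) (h1 : c.1 - 2 / 5 ≤ t) (h2 : t ≤ c.1 + 2 / 5) :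
    StabsPA 0.3 (vline t) (sqr c) := by
  constructor
  · refine pArea_lower c _ (c.1 - 1) t (c.2 - 1) (c.2 + 1) (by linarith) ?_
      (by norm_num; linarith)
    rintro ⟨x, y⟩ ⟨⟨hx1, hx2⟩, hy⟩
    simp only at hx1 hx2
    have hsq : ((x, y) : Pt) ∈ sqr c := ⟨⟨hx1, by simp only; linarith⟩, hy⟩
    refine ⟨⟨?_, hsq⟩, hsq⟩
    simp [DLine.left, vline, pcross]
    linarith
  · refine pArea_lower c _ t (c.1 + 1) (c.2 - 1) (c.2 + 1) (by linarith) ?_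
      (by norm_num; linarith)
    rintro ⟨x, y⟩ ⟨⟨hx1, hx2⟩, hy⟩
    simp only at hx1 hx2
    have hsq : ((x, y) : Pt) ∈ sqr c := ⟨⟨by simp only; linarith, hx2⟩, hy⟩
    refine ⟨⟨?_, hsq⟩, hsq⟩
    simp [DLine.right, vline, pcross]
    linarith

lemma stab_h (c : Pt) (t : ℝ) (h1 : c.2 - 2 / 5 ≤ t) (h2 : t ≤ c.2 + 2 / 5) :
    StabsPA 0.3 (hline t) (sqr c) := by
  constructor
  · refine pArea_lower c _ (c.1 - 1) (c.1 + 1) t (c.2 + 1) (by linarith) ?_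
      (by norm_num; linarith)
    rintro ⟨x, y⟩ ⟨hx, ⟨hy1, hy2⟩⟩
    simp only at hy1 hy2
    have hsq : ((x, y) : Pt) ∈ sqr c := ⟨hx, ⟨by simp only; linarith, hy2⟩⟩
    refine ⟨⟨?_, hsq⟩, hsq⟩
    simp [DLine.left, hline, pcross]
    linarith
  · refine pArea_lower c _ (c.1 - 1) (c.1 + 1) (c.2 - 1) t (by linarith) ?_
      (by norm_num; linarith)
    rintro ⟨x, y⟩ ⟨hx, ⟨hy1, hy2⟩⟩
    simp only at hy1 hy2
    have hsq : ((x, y) : Pt) ∈ sqr c := ⟨hx, ⟨hy1, by simp only; linarith⟩⟩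
    refine ⟨⟨?_, hsq⟩, hsq⟩
    simp [DLine.right, hline, pcross]
    linarith

/-- The line stabbing all squares other than the `m`-th one. -/
def ln : Fin 4 → DLine := ![vline (-(7 / 20)), vline (7 / 20), hline (-(7 / 20)), hline (7 / 20)]

lemma ln_stabs (m b : Fin 4) (h : b ≠ m) :
    StabsPA 0.3 (ln m) (sqr (ctr b)) ∧ (ln m).pt 0 ∈ sqr (ctr b) := by
  fin_cases m
  · change StabsPA 0.3 (vline (-(7 / 20))) (sqr (ctr b)) ∧ (vline (-(7 / 20))).pt 0 ∈ sqr (ctr b)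
    refine ⟨stab_v _ _ ?_ ?_, ?_⟩ <;> fin_cases b <;>
      simp_all [ctr, sqr, vline, DLine.pt] <;> norm_num
  · change StabsPA 0.3 (vline (7 / 20)) (sqr (ctr b)) ∧ (vline (7 / 20)).pt 0 ∈ sqr (ctr b)
    refine ⟨stab_v _ _ ?_ ?_, ?_⟩ <;> fin_cases b <;>
      simp_all [ctr, sqr, vline, DLine.pt] <;> norm_num
  · change StabsPA 0.3 (hline (-(7 / 20))) (sqr (ctr b)) ∧ (hline (-(7 / 20))).pt 0 ∈ sqr (ctr b)
    refine ⟨stab_h _ _ ?_ ?_, ?_⟩ <;> fin_cases b <;>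
      simp_all [ctr, sqr, hline, DLine.pt] <;> norm_num
  · change StabsPA 0.3 (hline (7 / 20)) (sqr (ctr b)) ∧ (hline (7 / 20)).pt 0 ∈ sqr (ctr b)
    refine ⟨stab_h _ _ ?_ ?_, ?_⟩ <;> fin_cases b <;>
      simp_all [ctr, sqr, hline, DLine.pt] <;> norm_num

lemma avoid3 : ∀ a b c : Fin 4, ∃ m : Fin 4, a ≠ m ∧ b ≠ m ∧ c ≠ m := by decide

lemma index_exists : ∀ (c : Fin 3) (m : Fin 4), ∃ i : Fin 12,
    (⟨i.1 % 3, Nat.mod_lt _ (by norm_num)⟩ : Fin 3) = c ∧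
    (⟨i.1 / 3, by omega⟩ : Fin 4) = m := by decide

/-- disjointness is necessary in the colorful quantitative Hadwiger
theorem: an ordered, three-colored family of overlapping compact convex sets with
percent-area functions and `α = 0.3` where every three differently colored sets have
an in-order `(f,α)`-transversal, but no color class has a common `(f,α)`-stabber. -/
theorem stmt18 :
    ∃ (n : ℕ) (A : Fin n → Set Pt) (color : Fin n → Fin 3),
      (∀ i, IsCompact (A i)) ∧ (∀ i, Convex ℝ (A i)) ∧ (∀ i, 0 < volume (A i)) ∧
      Function.Surjective color ∧
      (∃ i j : Fin n, i ≠ j ∧ ¬ Disjoint (A i) (A j)) ∧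
      (∀ i j k : Fin n, i < j → j < k →
        color i ≠ color j → color i ≠ color k → color j ≠ color k →
        ∃ ℓ : DLine, StabsPA 0.3 ℓ (A i) ∧ StabsPA 0.3 ℓ (A j) ∧ StabsPA 0.3 ℓ (A k) ∧
          Meets3 ℓ (A i) (A j) (A k)) ∧
      (∀ c : Fin 3, ¬ ∃ ℓ : DLine, ∀ i, color i = c → StabsPA 0.3 ℓ (A i)) := by
  refine ⟨12, fun i => sqr (ctr ⟨i.1 / 3, by omega⟩),
    fun i => ⟨i.1 % 3, Nat.mod_lt _ (by norm_num)⟩, ?_, ?_, ?_, ?_, ?_, ?_, ?_⟩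
  · intro i
    exact isCompact_Icc.prod isCompact_Icc
  · intro i
    exact (convex_Icc _ _).prod (convex_Icc _ _)
  · intro i
    rw [vol_sq]
    simp
  · intro c
    obtain ⟨i, hi, _⟩ := index_exists c 0
    exact ⟨i, hi⟩
  · refine ⟨0, 1, by decide, ?_⟩
    rw [Set.not_disjoint_iff]
    exact ⟨(7 / 10, 0), by norm_num [sqr, ctr], by norm_num [sqr, ctr]⟩
  · intro i j k _ _ _ _ _
    obtain ⟨m, h1, h2, h3⟩ := avoid3 ⟨i.1 / 3, by omega⟩ ⟨j.1 / 3, by omega⟩ ⟨k.1 / 3, by omega⟩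
    obtain ⟨a1, b1⟩ := ln_stabs m _ h1
    obtain ⟨a2, b2⟩ := ln_stabs m _ h2
    obtain ⟨a3, b3⟩ := ln_stabs m _ h3
    exact ⟨ln m, a1, a2, a3, 0, 0, 0, le_rfl, le_rfl, b1, b2, b3⟩
  · rintro c ⟨ℓ, hℓ⟩
    refine no_common ℓ fun m => ?_
    obtain ⟨i, hi, hm⟩ := index_exists c m
    have := hℓ i hi
    simpa only [hm] using this
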